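/- arXiv:1904.02595 — 3 statements merged into one kernel-verified Lean document; each statement's English description precedes it below -/
import Mathlib

section
/- If t ≥ 3 is an integer and x, ν, m are real numbers such that m/2 ≥ ν ≥ (2x−1)/x^4, x ≥ t, and m ≥ ω(t), then 1/x + 1/x^4 + ν − (1/(x−1))·ν^{1/η(t)} ≤ m. -/
open Classical
noncomputable section

/-- `η(t) = log t / log (t/(t-1))`. -/
def etaFn (t : ℕ) : ℝ := Real.log t / Real.log ((t : ℝ) / ((t : ℝ) - 1))

/-- The threshold `ω(t)` from the paper. -/
def omegaFn (t : ℕ) : ℝ :=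
  if t = 3 then 37 / 81 - (1 / 2) * ((5 / 81 : ℝ) ^ ((1 : ℝ) / etaFn 3))
  else if t = 4 then 85 / 256 - (1 / 3) * ((7 / 256 : ℝ) ^ ((1 : ℝ) / etaFn 4))
  else (4 * (t : ℝ) - 3) / (t : ℝ) ^ 3

/-- The exponent `1/η(t)`, which satisfies `t ^ (1/η(t)) = t/(t-1)`. -/
lemma one_div_etaFn (t : ℕ) :
    (1 : ℝ) / etaFn t = Real.log ((t : ℝ) / ((t : ℝ) - 1)) / Real.log t := by
  rw [etaFn, one_div_div]

lemma one_div_etaFn_pos {t : ℕ} (ht : 3 ≤ t) : 0 < (1 : ℝ) / etaFn t := by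
  have h : (3 : ℝ) ≤ t := by exact_mod_cast ht
  rw [one_div_etaFn]
  apply div_pos <;> apply Real.log_pos
  · rw [lt_div_iff₀ (by linarith)]; linarith
  · linarith

lemma one_le_log_natCast {t : ℕ} (ht : 3 ≤ t) : 1 ≤ Real.log t := by
  have h : (3 : ℝ) ≤ t := by exact_mod_cast ht
  rw [Real.le_log_iff_exp_le (by linarith)]
  linarith [Real.exp_one_lt_d9]

lemma one_div_etaFn_le {t : ℕ} (ht : 3 ≤ t) : (1 : ℝ) / etaFn t ≤ 1 / ((t : ℝ) - 1) := by
  have h : (3 : ℝ) ≤ t := by exact_mod_cast ht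
  have hlog := one_le_log_natCast ht
  have h1 : (0 : ℝ) < t - 1 := by linarith
  have hL : Real.log ((t : ℝ) / ((t : ℝ) - 1)) ≤ 1 / ((t : ℝ) - 1) := by
    refine (Real.log_le_sub_one_of_pos (by positivity)).trans_eq ?_
    field_simp
    ring
  rw [one_div_etaFn, div_le_iff₀ (by linarith)]
  exact hL.trans (le_mul_of_one_le_right (by positivity) hlog)

lemma rpow_neg_one_div_etaFn {t : ℕ} (ht : 3 ≤ t) :
    (t : ℝ) ^ (-((1 : ℝ) / etaFn t)) = 1 - 1 / t := by
  have h : (3 : ℝ) ≤ t := by exact_mod_cast ht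
  have hlog := one_le_log_natCast ht
  have h1 : (0 : ℝ) < t - 1 := by linarith
  rw [Real.rpow_neg (by linarith), Real.rpow_def_of_pos (by linarith), one_div_etaFn,
    mul_div_cancel₀ _ (by linarith), Real.exp_log (by positivity)]
  field_simp

lemma rpow_neg_le {t : ℕ} (ht : 3 ≤ t) {x : ℝ} (hx : (t : ℝ) ≤ x) :
    x ^ (-((1 : ℝ) / etaFn t)) ≤ 1 - 1 / t := by
  have h : (3 : ℝ) ≤ t := by exact_mod_cast ht
  rw [← rpow_neg_one_div_etaFn ht]
  exact Real.rpow_le_rpow_of_nonpos (by linarith) hx (by linarith [one_div_etaFn_pos ht])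

/-- A linear lower bound for `x ^ (-1/η(t))`, exact at `x = t`. -/
lemma le_rpow_neg {t : ℕ} (ht : 3 ≤ t) {x : ℝ} (hx : (t : ℝ) ≤ x) :
    1 - x / (t : ℝ) ^ 2 ≤ x ^ (-((1 : ℝ) / etaFn t)) := by
  have h : (3 : ℝ) ≤ t := by exact_mod_cast ht
  have ha := one_div_etaFn_pos ht
  have ha' := one_div_etaFn_le ht
  have ht' := rpow_neg_one_div_etaFn ht
  set a := (1 : ℝ) / etaFn t
  have h0 : (0 : ℝ) < t := by linarith
  have h1 : (0 : ℝ) < t - 1 := by linarith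
  have hs : 0 < x / t := div_pos (by linarith) h0
  have hs1 : 1 ≤ x / t := (one_le_div h0).2 hx
  have hexp : 1 - a * (x / t - 1) ≤ (x / t) ^ (-a) := by
    rw [Real.rpow_def_of_pos hs]
    nlinarith [Real.add_one_le_exp (Real.log (x / t) * -a), Real.log_le_sub_one_of_pos hs]
  have hx' : x ^ (-a) = (1 - 1 / t) * (x / t) ^ (-a) := by
    rw [← ht', ← Real.mul_rpow h0.le hs.le, mul_div_cancel₀ _ h0.ne']
  have hq : (0 : ℝ) ≤ 1 - 1 / t := by
    rw [sub_nonneg, div_le_one h0]; linarith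
  have hqa : (1 - 1 / t) * a ≤ 1 / t := by
    refine (mul_le_mul_of_nonneg_left ha' hq).trans_eq ?_
    field_simp
  have hxt : x / (t : ℝ) ^ 2 = 1 / t * (x / t) := by field_simp
  rw [hx', hxt]
  nlinarith [mul_le_mul_of_nonneg_left hexp hq,
    mul_le_mul_of_nonneg_right hqa (sub_nonneg.2 hs1)]

lemma inv_pow_rpow {x : ℝ} (hx : 0 < x) (a : ℝ) (n : ℕ) : (1 / x ^ n) ^ a = (x ^ (-a)) ^ n := by
  rw [one_div, Real.inv_rpow (by positivity), Real.rpow_neg hx.le, inv_pow,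
    ← Real.rpow_natCast, ← Real.rpow_natCast, ← Real.rpow_mul hx.le, ← Real.rpow_mul hx.le,
    mul_comm]

lemma convexOn_sub_mul_rpow (b : ℝ) {c a : ℝ} (hc : 0 ≤ c) (ha : 0 ≤ a) (ha1 : a ≤ 1) :
    ConvexOn ℝ (Set.Ici 0) fun v : ℝ => b + v - c * v ^ a := by
  have h := ((Real.concaveOn_rpow ha ha1).smul hc).neg
  exact ((convexOn_const b (convex_Ici 0)).add (convexOn_id (convex_Ici 0))).add h |>.congr
    fun v _ => by simp [sub_eq_add_neg]

/-- The inequality at the right endpoint `ν = m/2`. -/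
lemma right_endpoint_le {t : ℕ} (ht : 3 ≤ t) {x m : ℝ} (hx : (t : ℝ) ≤ x)
    (hm : 2 / (t : ℝ) ^ 2 + 2 / (t : ℝ) ^ 4 ≤ m) :
    1 / x + 1 / x ^ 4 + m / 2 - 1 / (x - 1) * (m / 2) ^ ((1 : ℝ) / etaFn t) ≤ m := by
  have h : (3 : ℝ) ≤ t := by exact_mod_cast ht
  have h0 : (0 : ℝ) < t := by linarith
  have hx0 : 0 < x := by linarith
  have hx1 : 0 < x - 1 := by linarith
  have e2 : 2 / (t : ℝ) ^ 2 = 2 * (1 / (t : ℝ) ^ 2) := by ring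
  have e4 : 2 / (t : ℝ) ^ 4 = 2 * (1 / (t : ℝ) ^ 4) := by ring
  have h4 : 0 < 1 / (t : ℝ) ^ 4 := by positivity
  have hpow : (1 - 1 / (t : ℝ)) ^ 2 ≤ (m / 2) ^ ((1 : ℝ) / etaFn t) := by
    rw [← rpow_neg_one_div_etaFn ht, ← inv_pow_rpow h0]
    exact Real.rpow_le_rpow (by positivity) (by linarith) (one_div_etaFn_pos ht).le
  have hmul := mul_le_mul_of_nonneg_left hpow (one_div_pos.2 hx1).le
  have hx4 : 1 / x ^ 4 ≤ 1 / (t : ℝ) ^ 4 := by gcongr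
  have key : 1 / x - 1 / (x - 1) * (1 - 1 / (t : ℝ)) ^ 2 ≤ 1 / (t : ℝ) ^ 2 := by
    have : 1 / (t : ℝ) ^ 2 - (1 / x - 1 / (x - 1) * (1 - 1 / (t : ℝ)) ^ 2)
        = (x - t) ^ 2 / (t ^ 2 * x * (x - 1)) := by
      field_simp
      ring
    have : 0 ≤ (x - t) ^ 2 / (t ^ 2 * x * (x - 1)) := by positivity
    linarith
  linarith

/-- The inequality at the left endpoint `ν = (2x-1)/x^4`, in terms of `x ^ (-1/η(t))`. -/
lemma left_endpoint_le {t : ℕ} (ht : 3 ≤ t) {x m : ℝ} (hx : (t : ℝ) ≤ x)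
    (hm : 1 / x + 2 / x ^ 3 - (x ^ (-((1 : ℝ) / etaFn t))) ^ 3 / (x - 1) ≤ m) :
    1 / x + 1 / x ^ 4 + (2 * x - 1) / x ^ 4
      - 1 / (x - 1) * ((2 * x - 1) / x ^ 4) ^ ((1 : ℝ) / etaFn t) ≤ m := by
  have h : (3 : ℝ) ≤ t := by exact_mod_cast ht
  have hx0 : 0 < x := by linarith
  have hx1 : 0 < x - 1 := by linarith
  have hle : 1 / x ^ 3 ≤ (2 * x - 1) / x ^ 4 := by
    rw [div_le_div_iff₀ (by positivity) (by positivity)]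
    nlinarith [pow_pos hx0 3]
  have hpow : (x ^ (-((1 : ℝ) / etaFn t))) ^ 3 ≤ ((2 * x - 1) / x ^ 4) ^ ((1 : ℝ) / etaFn t) := by
    rw [← inv_pow_rpow hx0]
    exact Real.rpow_le_rpow (by positivity) hle (one_div_etaFn_pos ht).le
  have hmul := mul_le_mul_of_nonneg_left hpow (one_div_pos.2 hx1).le
  have e : 1 / x ^ 4 + (2 * x - 1) / x ^ 4 = 2 / x ^ 3 := by field_simp; ring
  rw [one_div_mul_eq_div] at hmul
  linarith

lemma le_of_endpoints {t : ℕ} (ht : 3 ≤ t) {x ν m : ℝ} (hx : (t : ℝ) ≤ x)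
    (h1 : ν ≤ m / 2) (h2 : (2 * x - 1) / x ^ 4 ≤ ν)
    (hm : 2 / (t : ℝ) ^ 2 + 2 / (t : ℝ) ^ 4 ≤ m)
    (hm' : 1 / x + 2 / x ^ 3 - (x ^ (-((1 : ℝ) / etaFn t))) ^ 3 / (x - 1) ≤ m) :
    1 / x + 1 / x ^ 4 + ν - 1 / (x - 1) * ν ^ ((1 : ℝ) / etaFn t) ≤ m := by
  have h : (3 : ℝ) ≤ t := by exact_mod_cast ht
  have hν : 0 ≤ (2 * x - 1) / x ^ 4 := div_nonneg (by linarith) (by positivity)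
  have ha1 : (1 : ℝ) / etaFn t ≤ 1 :=
    (one_div_etaFn_le ht).trans (by rw [div_le_one (by linarith)]; linarith)
  have hconv := convexOn_sub_mul_rpow (1 / x + 1 / x ^ 4)
    (one_div_nonneg.2 (show 0 ≤ x - 1 by linarith)) (one_div_etaFn_pos ht).le ha1
  exact (hconv.le_max_of_mem_Icc hν (Set.mem_Ici.2 (hν.trans (h2.trans h1))) ⟨h2, h1⟩).trans
    (max_le (left_endpoint_le ht hx hm') (right_endpoint_le ht hx hm))

/-- `b ^ (1/η(t)) ≤ r` follows from `b² ≤ t⁻⁵` and `(1 - 1/t)⁵ ≤ r²`. -/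
lemma rpow_one_div_etaFn_le {t : ℕ} (ht : 3 ≤ t) {b r : ℝ} (hb : 0 ≤ b) (hr : 0 ≤ r)
    (hbt : b ^ 2 ≤ 1 / (t : ℝ) ^ 5) (hrt : (1 - 1 / (t : ℝ)) ^ 5 ≤ r ^ 2) :
    b ^ ((1 : ℝ) / etaFn t) ≤ r := by
  have h : (0 : ℝ) < t := by positivity
  refine le_of_sq_le_sq ?_ hr
  refine le_trans ?_ hrt
  rw [← rpow_neg_one_div_etaFn ht, ← inv_pow_rpow h, ← Real.rpow_natCast, ← Real.rpow_mul hb,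
    mul_comm, Real.rpow_mul hb, Real.rpow_natCast]
  exact Real.rpow_le_rpow (by positivity) hbt (one_div_etaFn_pos ht).le

lemma le_omegaFn_three : 11 / 40 ≤ omegaFn 3 := by
  have := rpow_one_div_etaFn_le (t := 3) le_rfl (b := 5 / 81) (r := 363 / 1000)
    (by norm_num) (by norm_num) (by norm_num) (by norm_num)
  simp only [omegaFn, if_true]
  linarith

lemma le_omegaFn_four : 169 / 1000 ≤ omegaFn 4 := by
  have := rpow_one_div_etaFn_le (t := 4) (by norm_num) (b := 7 / 256) (r := 488 / 1000)
    (by norm_num) (by norm_num) (by norm_num) (by norm_num)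
  simp only [omegaFn, if_true]
  norm_num at this ⊢
  linarith

lemma omegaFn_of_five_le {t : ℕ} (ht : 5 ≤ t) :
    omegaFn t = (4 * (t : ℝ) - 3) / (t : ℝ) ^ 3 := by
  rw [omegaFn, if_neg (by omega), if_neg (by omega)]

lemma left_bound_three {x p : ℝ} (hx : 3 ≤ x) (hp : 0 ≤ p) (hxp : 1 - x / 9 ≤ p) :
    1 / x + 2 / x ^ 3 - p ^ 3 / (x - 1) ≤ 11 / 40 := by
  have hx1 : 0 < x - 1 := by linarith
  rcases le_total x (9 / 2) with h | h
  · have hp3 : (1 - x / 9) ^ 3 ≤ p ^ 3 := pow_le_pow_left₀ (by linarith) hxp 3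
    have hdiv : (1 - x / 9) ^ 3 / (x - 1) ≤ p ^ 3 / (x - 1) := by gcongr
    have key : 1 / x + 2 / x ^ 3 - (1 - x / 9) ^ 3 / (x - 1) ≤ 11 / 40 := by
      obtain ⟨y, rfl⟩ : ∃ y, x = y + 3 := ⟨x - 3, by ring⟩
      have hy : 0 ≤ y := by linarith
      have hy6 : 0 ≤ y ^ 5 * (5 - y) := mul_nonneg (by positivity) (by linarith)
      rw [← sub_nonneg]
      have hpos : 0 < (y + 3) ^ 3 * (y + 3 - 1) := by positivity
      refine nonneg_of_mul_nonneg_left ?_ hpos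
      have hy2 := pow_nonneg hy 2
      have hy3 := pow_nonneg hy 3
      have hy4 := pow_nonneg hy 4
      have hy5 := pow_nonneg hy 5
      field_simp
      linarith
    linarith
  · have : 1 / x ≤ 1 / (9 / 2) := by gcongr
    have : 2 / x ^ 3 ≤ 2 / (9 / 2) ^ 3 := by gcongr
    have : 0 ≤ p ^ 3 / (x - 1) := by positivity
    norm_num at *
    linarith

lemma left_bound_four {x p : ℝ} (hx : 4 ≤ x) (hp : 0 ≤ p) (hxp : 1 - x / 16 ≤ p) :
    1 / x + 2 / x ^ 3 - p ^ 3 / (x - 1) ≤ 169 / 1000 := by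
  have hx1 : 0 < x - 1 := by linarith
  rcases le_total x 8 with h | h
  · have hp3 : (1 - x / 16) ^ 3 ≤ p ^ 3 := pow_le_pow_left₀ (by linarith) hxp 3
    have hdiv : (1 - x / 16) ^ 3 / (x - 1) ≤ p ^ 3 / (x - 1) := by gcongr
    have key : 1 / x + 2 / x ^ 3 - (1 - x / 16) ^ 3 / (x - 1) ≤ 169 / 1000 := by
      obtain ⟨y, rfl⟩ : ∃ y, x = y + 4 := ⟨x - 4, by ring⟩
      have hy : 0 ≤ y := by linarith
      have hy6 : 0 ≤ y ^ 5 * (5 - y) := mul_nonneg (by positivity) (by linarith)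
      rw [← sub_nonneg]
      have hpos : 0 < (y + 4) ^ 3 * (y + 4 - 1) := by positivity
      refine nonneg_of_mul_nonneg_left ?_ hpos
      have hy2 := pow_nonneg hy 2
      have hy3 := pow_nonneg hy 3
      have hy4 := pow_nonneg hy 4
      have hy5 := pow_nonneg hy 5
      field_simp
      linarith
    linarith
  · have : 1 / x ≤ 1 / 8 := by gcongr
    have : 2 / x ^ 3 ≤ 2 / 8 ^ 3 := by gcongr
    have : 0 ≤ p ^ 3 / (x - 1) := by positivity
    norm_num at *
    linarith

lemma left_bound_of_five_le {t x p : ℝ} (ht : 5 ≤ t) (hx : t ≤ x) (hp : 0 ≤ p)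
    (hpt : p ≤ 1 - 1 / t) (hxp : 1 - x / t ^ 2 ≤ p) :
    1 / x + 2 / x ^ 3 - p ^ 3 / (x - 1) ≤ (4 * t - 3) / t ^ 3 := by
  have ht0 : 0 < t := by linarith
  have hx0 : 0 < x := by linarith
  have ht1 : 0 < t - 1 := by linarith
  have hx1 : 0 < x - 1 := by linarith
  have hcube : 1 - p ^ 3 ≤ x / t ^ 2 * (1 + (1 - 1 / t) + (1 - 1 / t) ^ 2) := by
    calc 1 - p ^ 3 = (1 - p) * (1 + p + p ^ 2) := by ring
      _ ≤ x / t ^ 2 * (1 + (1 - 1 / t) + (1 - 1 / t) ^ 2) := by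
        gcongr
        linarith
  have hdiv : (1 - p ^ 3) / (x - 1) ≤ (3 * t ^ 2 - 3 * t + 1) / (t ^ 3 * (t - 1)) := by
    calc (1 - p ^ 3) / (x - 1)
        ≤ x / t ^ 2 * (1 + (1 - 1 / t) + (1 - 1 / t) ^ 2) / (x - 1) := by gcongr
      _ = x / (x - 1) * ((3 * t ^ 2 - 3 * t + 1) / t ^ 4) := by field_simp; ring
      _ ≤ t / (t - 1) * ((3 * t ^ 2 - 3 * t + 1) / t ^ 4) := by
        refine mul_le_mul_of_nonneg_right ?_ (div_nonneg (by nlinarith) (by positivity))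
        rw [div_le_div_iff₀ hx1 ht1]
        linarith
      _ = (3 * t ^ 2 - 3 * t + 1) / (t ^ 3 * (t - 1)) := by field_simp
  have hsmall : 1 / x + 2 / x ^ 3 ≤ 1 / (x - 1) := by
    rw [div_add_div _ _ (by positivity) (by positivity),
      div_le_div_iff₀ (by positivity) hx1]
    nlinarith [mul_pos hx0 hx1, mul_pos hx0 hx0]
  have hlast : (3 * t ^ 2 - 3 * t + 1) / (t ^ 3 * (t - 1)) ≤ (4 * t - 3) / t ^ 3 := by
    rw [← div_div, div_right_comm]
    gcongr
    rw [div_le_iff₀ ht1]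
    nlinarith
  have : (1 - p ^ 3) / (x - 1) = 1 / (x - 1) - p ^ 3 / (x - 1) := sub_div _ _ _
  linarith

lemma two_div_add_le_of_five_le {t : ℝ} (ht : 5 ≤ t) :
    2 / t ^ 2 + 2 / t ^ 4 ≤ (4 * t - 3) / t ^ 3 := by
  have ht0 : 0 < t := by linarith
  have : (4 * t - 3) / t ^ 3 - (2 / t ^ 2 + 2 / t ^ 4) = (2 * t ^ 2 - 3 * t - 2) / t ^ 4 := by
    field_simp
    ring
  have : 0 ≤ (2 * t ^ 2 - 3 * t - 2) / t ^ 4 := div_nonneg (by nlinarith) (by positivity)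
  linarith

/-- Lemma 7 of the paper. If `t ≥ 3` is an integer and `x, ν, m` are
real numbers with `m/2 ≥ ν ≥ (2x-1)/x^4`, `x ≥ t`, and `m ≥ ω(t)`, then
`1/x + 1/x^4 + ν - (1/(x-1)) ν^{1/η(t)} ≤ m`. -/
theorem statement15 (t : ℕ) (ht : 3 ≤ t) (x ν m : ℝ)
    (h1 : m / 2 ≥ ν) (h2 : ν ≥ (2 * x - 1) / x ^ 4)
    (h3 : x ≥ (t : ℝ)) (h4 : m ≥ omegaFn t) :
    1 / x + 1 / x ^ 4 + ν - 1 / (x - 1) * ν ^ ((1 : ℝ) / etaFn t) ≤ m := by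
  have hp : 0 ≤ x ^ (-((1 : ℝ) / etaFn t)) :=
    Real.rpow_nonneg ((Nat.cast_nonneg t).trans h3) _
  have hpt := rpow_neg_le ht h3
  have hxp := le_rpow_neg ht h3
  have reduce {w : ℝ} (hw : w ≤ m) (hwt : 2 / (t : ℝ) ^ 2 + 2 / (t : ℝ) ^ 4 ≤ w)
      (hwx : 1 / x + 2 / x ^ 3 - (x ^ (-((1 : ℝ) / etaFn t))) ^ 3 / (x - 1) ≤ w) :=
    le_of_endpoints ht h3 h1 h2 (hwt.trans hw) (hwx.trans hw)
  obtain rfl | rfl | h5 : t = 3 ∨ t = 4 ∨ 5 ≤ t := by omega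
  · refine reduce (le_omegaFn_three.trans h4) (by norm_num) (left_bound_three ?_ hp ?_)
    · exact_mod_cast h3
    · norm_num at hxp ⊢
      exact hxp
  · refine reduce (le_omegaFn_four.trans h4) (by norm_num) (left_bound_four ?_ hp ?_)
    · exact_mod_cast h3
    · norm_num at hxp ⊢
      exact hxp
  · have h : (5 : ℝ) ≤ t := by exact_mod_cast h5
    exact reduce ((omegaFn_of_five_le h5).symm.trans_le h4) (two_div_add_le_of_five_le h)
      (left_bound_of_five_le h h3 hp hpt hxp)
end
end

section
/- Let 0 < β ≤ 1/2 be a real number and set c = log_β(1−β) = ln(1−β)/ln β. Then for every real x with β ≤ x ≤ 1, x^c + β·((1−x)/(1−β))^c ≥ 1. -/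
open Classical
noncomputable section

/-- Let `0 < β ≤ 1/2` and `c = log_β(1-β) = ln(1-β)/ln β`. Then for
every real `x` with `β ≤ x ≤ 1`, `x^c + β ((1-x)/(1-β))^c ≥ 1`. -/
theorem statement16 (β : ℝ) (hβ0 : 0 < β) (hβ2 : β ≤ 1 / 2)
    (x : ℝ) (hx1 : β ≤ x) (hx2 : x ≤ 1) :
    x ^ (Real.log (1 - β) / Real.log β) +
      β * ((1 - x) / (1 - β)) ^ (Real.log (1 - β) / Real.log β) ≥ 1 := by
  set c := Real.log (1 - β) / Real.log β with hc
  have hβ1 : 0 < 1 - β := by linarith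
  have hlogβ : Real.log β < 0 := Real.log_neg hβ0 (by linarith)
  have hlog : Real.log (1 - β) < 0 := Real.log_neg hβ1 (by linarith)
  have hc0 : 0 ≤ c := (div_pos_of_neg_of_neg hlog hlogβ).le
  have hc1 : c ≤ 1 :=
    (div_le_one_of_neg hlogβ).2 (Real.log_le_log hβ0 (by linarith))
  have hβc : β ^ c = 1 - β := by
    rw [Real.rpow_def_of_pos hβ0, hc, mul_div_cancel₀ _ hlogβ.ne, Real.exp_log hβ1]
  set t := (1 - x) / (1 - β) with ht
  have ht0 : 0 ≤ t := div_nonneg (by linarith) hβ1.le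
  have ht1 : t ≤ 1 := (div_le_one hβ1).2 (by linarith)
  have hx : t * β + (1 - t) = x := by
    rw [ht]
    field_simp
    ring
  have concave := Real.concaveOn_rpow hc0 hc1
  have chord : t * (1 - β) + (1 - t) ≤ x ^ c := by
    have h := concave.2 (Set.mem_Ici.2 hβ0.le) (Set.mem_Ici.2 zero_le_one) ht0
      (sub_nonneg.2 ht1) (add_sub_cancel t 1)
    simpa only [smul_eq_mul, hx, hβc, Real.one_rpow, mul_one] using h
  have le_rpow : t ≤ t ^ c := Real.self_le_rpow_of_le_one ht0 ht1 hc1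
  have := mul_le_mul_of_nonneg_left le_rpow hβ0.le
  linarith
end
end

section
/- For all integers t_j ≥ t_n ≥ 3, t_j·(2t_n−1)/t_n^3 − 1/t_j^3 + (t_j·t_n/((t_j−1)(t_n−1)))·(1/t_j^3)^{1/η(t_n)} > 1. -/
open Classical
noncomputable section

/-- The exponent `3 / η(n)` is at most `(2n-1)/(n-1)^2`, stated without division by `log n`. -/
lemma three_mul_log_div_sub_one_le (n : ℕ) (hn : 3 ≤ n) :
    3 * Real.log ((n : ℝ) / ((n : ℝ) - 1)) ≤
      (2 * (n : ℝ) - 1) / ((n : ℝ) - 1) ^ 2 * Real.log n := by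
  obtain rfl | rfl | h5 : n = 3 ∨ n = 4 ∨ 5 ≤ n := by omega
  · have h : Real.log ((3 / 2 : ℝ) ^ 12) ≤ Real.log (3 ^ 5) :=
      Real.log_le_log (by norm_num) (by norm_num)
    rw [Real.log_pow, Real.log_pow] at h
    norm_num at h ⊢
    linarith
  · have h : Real.log ((4 / 3 : ℝ) ^ 27) ≤ Real.log (4 ^ 7) :=
      Real.log_le_log (by norm_num) (by norm_num)
    rw [Real.log_pow, Real.log_pow] at h
    norm_num at h ⊢
    linarith
  · have hn5 : (5 : ℝ) ≤ n := by exact_mod_cast h5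
    have hm : (0 : ℝ) < n - 1 := by linarith
    have hlog : 3 / 2 ≤ Real.log n := by
      have h25 : (3 : ℝ) ≤ Real.log (5 ^ 2) := by
        rw [Real.le_log_iff_exp_le (by norm_num)]
        calc Real.exp 3 = Real.exp 1 ^ 3 := by rw [← Real.exp_nat_mul]; norm_num
          _ ≤ 2.72 ^ 3 := by
            gcongr
            linarith [Real.exp_one_lt_d9]
          _ ≤ 5 ^ 2 := by norm_num
      rw [Real.log_pow] at h25
      have := Real.log_le_log (by norm_num) hn5
      push_cast at h25
      linarith
    have hle : Real.log ((n : ℝ) / (n - 1)) ≤ 1 / (n - 1) := by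
      have h := Real.log_le_sub_one_of_pos (x := (n : ℝ) / (n - 1)) (by positivity)
      have e : (n : ℝ) / (n - 1) - 1 = 1 / (n - 1) := by field_simp; ring
      linarith
    calc 3 * Real.log ((n : ℝ) / (n - 1)) ≤ 3 * (1 / (n - 1)) := by gcongr
      _ = 2 / (n - 1) * (3 / 2) := by ring
      _ ≤ (2 * n - 1) / (n - 1) ^ 2 * Real.log n := by
        refine mul_le_mul ?_ hlog (by norm_num) (div_nonneg (by linarith) (by positivity))
        rw [div_le_div_iff₀ hm (by positivity)]
        nlinarith

/-- For all integers `t_j ≥ t_n ≥ 3`,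
`t_j (2t_n-1)/t_n^3 - 1/t_j^3 + (t_j t_n/((t_j-1)(t_n-1))) (1/t_j^3)^{1/η(t_n)} > 1`. -/
theorem statement17 (tj tn : ℕ) (htn : 3 ≤ tn) (htj : tn ≤ tj) :
    (tj : ℝ) * (2 * (tn : ℝ) - 1) / (tn : ℝ) ^ 3 - 1 / (tj : ℝ) ^ 3 +
      (tj : ℝ) * (tn : ℝ) / (((tj : ℝ) - 1) * ((tn : ℝ) - 1)) *
        (1 / (tj : ℝ) ^ 3) ^ ((1 : ℝ) / etaFn tn) > 1 := by
  have hc := three_mul_log_div_sub_one_le tn htn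
  unfold etaFn
  have hn : (3 : ℝ) ≤ tn := by exact_mod_cast htn
  have ht : (tn : ℝ) ≤ tj := by exact_mod_cast htj
  generalize (tn : ℝ) = n at *
  generalize (tj : ℝ) = t at *
  have hn0 : 0 < n := by linarith
  have ht0 : 0 < t := by linarith
  have hn1 : 0 < n - 1 := by linarith
  have ht1 : 0 < t - 1 := by linarith
  have hlogn : 0 < Real.log n := Real.log_pos (by linarith)
  have hlogq : 0 < Real.log (n / (n - 1)) := Real.log_pos (by rw [lt_div_iff₀ hn1]; linarith)
  have hs1 : 1 ≤ t / n := by rwa [one_le_div hn0]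
  have hlogs : 0 ≤ Real.log (t / n) := Real.log_nonneg hs1
  set q := Real.log (n / (n - 1)) with hq
  set c := 3 * q / Real.log n with hcdef
  have hcle : c ≤ (2 * n - 1) / (n - 1) ^ 2 := by rwa [hcdef, div_le_iff₀ hlogn]
  have hP : (1 / t ^ 3) ^ (1 / (Real.log n / q)) =
      ((n - 1) / n) ^ 3 * Real.exp (-(c * Real.log (t / n))) := by
    have hr : ((n - 1) / n) ^ 3 = Real.exp (-(3 * q)) := by
      have e : Real.log (((n - 1) / n) ^ 3) = -(3 * q) := by
        rw [Real.log_pow, hq, ← inv_div, Real.log_inv]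
        push_cast
        ring
      rw [← e, Real.exp_log (by positivity)]
    rw [hr, ← Real.exp_add, Real.rpow_def_of_pos (by positivity), one_div, Real.log_inv,
      Real.log_pow, Real.log_div ht0.ne' hn0.ne', hcdef]
    congr 1
    push_cast
    field_simp
    ring
  rw [hP]
  have hlin : 1 - (2 * n - 1) / (n - 1) ^ 2 * (t / n - 1) ≤
      Real.exp (-(c * Real.log (t / n))) := by
    have h1 := Real.add_one_le_exp (-(c * Real.log (t / n)))
    have h2 : c * Real.log (t / n) ≤ (2 * n - 1) / (n - 1) ^ 2 * (t / n - 1) :=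
      mul_le_mul hcle (Real.log_le_sub_one_of_pos (by positivity)) hlogs
        (div_nonneg (by linarith) (by positivity))
    linarith
  have hsq : (n / t) ^ 2 ≤ Real.exp (-(c * Real.log (t / n))) := by
    have hc2 : c ≤ 2 := hcle.trans (by rw [div_le_iff₀ (by positivity)]; nlinarith)
    have e : Real.log ((n / t) ^ 2) = -(2 * Real.log (t / n)) := by
      rw [Real.log_pow, ← inv_div, Real.log_inv]
      push_cast
      ring
    rw [← Real.exp_log (show 0 < (n / t) ^ 2 by positivity), e]
    gcongr
  set E := Real.exp (-(c * Real.log (t / n)))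
  have hmain : 1 ≤ t * (2 * n - 1) / n ^ 3 + ((n - 1) / n) ^ 2 * E := by
    calc 1 = t * (2 * n - 1) / n ^ 3 +
          ((n - 1) / n) ^ 2 * (1 - (2 * n - 1) / (n - 1) ^ 2 * (t / n - 1)) := by
          field_simp
          ring
      _ ≤ _ := by gcongr
  have hrest : 1 / t ^ 3 < ((n - 1) / n) ^ 2 * E / (t - 1) := by
    calc 1 / t ^ 3 < (n - 1) ^ 2 / (t ^ 2 * (t - 1)) := by
          rw [div_lt_div_iff₀ (by positivity) (by positivity)]
          have h4 : 4 ≤ (n - 1) ^ 2 := by nlinarith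
          nlinarith [mul_le_mul_of_nonneg_right h4 (pow_pos ht0 3).le, pow_pos ht0 2, pow_pos ht0 3]
      _ = ((n - 1) / n) ^ 2 * (n / t) ^ 2 / (t - 1) := by field_simp
      _ ≤ _ := by gcongr
  have hsplit : t * n / ((t - 1) * (n - 1)) * (((n - 1) / n) ^ 3 * E) =
      ((n - 1) / n) ^ 2 * E + ((n - 1) / n) ^ 2 * E / (t - 1) := by
    field_simp
    ring
  linarith
end
end
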